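/- arXiv:2107.02131 — 2 statements merged into one kernel-verified Lean document; each statement's English description precedes it below -/
import Mathlib

section
/- There exists an absolute constant C > 0 with the following property. Let p > 2 be a prime, q a power of p, let d ≥ 1 be an odd integer coprime with p, and let Q denote either x^d or x^{d+1} in F_q[x]. Let A ⊆ (F_q[x]/Q)^× be the subgroup of residues of polynomials u with u(0) ≠ 0 that are congruent modulo Q to a polynomial in F_q[x^2], and let B ⊆ (F_q[x]/Q)^× be the subgroup of residues of polynomials u with u(0) ≠ 0 that are congruent modulo Q to a polynomial in F_q[x^p]. Then for every integer r ≥ 1, |ψ(r; AB) − 1_{2|r}·q^{r/2}| ≤ C·(r·q^{r/3+3ω} + r·q^{r−(1/2−1/(2p))d+3}), where 1_{2|r} equals 1 if r is even and 0 otherwise, and ω = 1 if r > d/4 − 1 and ω = 0 otherwise. -/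
open Polynomial

/-- The von Mangoldt function on `F_q[x]`: `Λ(c) = deg P` if `c = P^k` for a monic
irreducible `P` and `k ≥ 1`, and `Λ(c) = 0` otherwise. -/
noncomputable def vM {F : Type*} [Field F] (c : Polynomial F) : ℕ :=
  sSup {n : ℕ | ∃ (P : Polynomial F) (k : ℕ),
    P.Monic ∧ Irreducible P ∧ 1 ≤ k ∧ c = P ^ k ∧ n = P.natDegree}


/-- `c(-x)`. -/
noncomputable def ng {F : Type*} [Field F] (c : Polynomial F) : Polynomial F := c.comp (-X)

/-- Wronskian of `c(x)` and `c(-x)`. -/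
noncomputable def wr {F : Type*} [Field F] (c : Polynomial F) : Polynomial F :=
  derivative c * ng c - c * derivative (ng c)

section basics
variable {F : Type*} [Field F]

lemma ng_add (a b : F[X]) : ng (a + b) = ng a + ng b := by simp [ng]
lemma ng_sub (a b : F[X]) : ng (a - b) = ng a - ng b := by simp [ng]
lemma ng_mul (a b : F[X]) : ng (a * b) = ng a * ng b := by simp [ng, mul_comp]
lemma ng_pow (a : F[X]) (k : ℕ) : ng (a ^ k) = ng a ^ k := by simp [ng, pow_comp]
lemma ng_ng (a : F[X]) : ng (ng a) = a := by
  simp [ng, comp_assoc]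
lemma ng_coeff (a : F[X]) (n : ℕ) : (ng a).coeff n = (-1) ^ n * a.coeff n := by
  unfold ng
  rw [show (-X : F[X]) = C (-1) * X by simp, comp_C_mul_X_coeff, mul_comm]
lemma ng_natDegree (a : F[X]) : (ng a).natDegree = a.natDegree := by
  simp [ng, natDegree_comp]
lemma ng_eval (a : F[X]) : (ng a).eval 0 = a.eval 0 := by simp [ng]

lemma wr_dvd {p d : ℕ} [CharP F p] (c a b : F[X])
    (h : X ^ d ∣ c - a.comp (X ^ 2) * b.comp (X ^ p)) : X ^ (d - 1) ∣ wr c := by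
  obtain ⟨h, hh⟩ := h
  set α := a.comp (X ^ 2) with hα
  set β := b.comp (X ^ p) with hβ
  have h1 : ng α = α := by simp [ng, hα, comp_assoc]
  have h2 : derivative β = 0 := by
    rw [hβ, derivative_comp, derivative_X_pow]; simp
  have h3 : derivative (ng β) = 0 := by
    simp [ng, derivative_comp, h2]
  have hc : c = α * β + X ^ d * h := by rw [← hh]; ring
  have hn : ng c = α * ng β + X ^ d * ((-1) ^ d * ng h) := by
    rw [hc, ng_add, ng_mul, ng_mul, h1, ng_pow]
    have : ng (X : F[X]) = - X := by simp [ng]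
    rw [this, neg_pow]; ring
  have key : ∀ g : F[X], ∃ k, derivative (X ^ d * g) = X ^ (d - 1) * k := by
    intro g
    rcases d with _ | d
    · exact ⟨derivative g, by simp⟩
    · refine ⟨C ((d + 1 : ℕ) : F) * g + X * derivative g, ?_⟩
      rw [derivative_mul, derivative_X_pow, Nat.add_sub_cancel]; ring
  obtain ⟨k1, hk1⟩ := key h
  obtain ⟨k2, hk2⟩ := key ((-1) ^ d * ng h)
  have hXd : ∃ e, (X : F[X]) ^ d = X ^ (d - 1) * e := pow_dvd_pow _ (Nat.sub_le d 1)
  obtain ⟨e, he⟩ := hXd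
  have hd1 : derivative c = derivative α * β + X ^ (d - 1) * k1 := by
    rw [hc, derivative_add, derivative_mul, h2, hk1]; ring
  have hd2 : derivative (ng c) = derivative α * ng β + X ^ (d - 1) * k2 := by
    rw [hn, derivative_add, derivative_mul, h3, hk2]; ring
  unfold wr
  rw [hd1, hd2, hn, hc, he]
  generalize (X : F[X]) ^ (d - 1) = Y
  generalize (-1 : F[X]) ^ d * ng h = h'
  refine ⟨derivative α * β * (e * h') + k1 * (α * ng β + Y * e * h') - α * β * k2
    - e * h * (derivative α * ng β + Y * k2), ?_⟩
  ring

lemma wr_sq {n : ℕ} (h2 : (2 : F) ≠ 0) (P : F[X]) (hP : P.eval 0 ≠ 0)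
    (h : X ^ n ∣ wr (P ^ 2)) : X ^ n ∣ wr P := by
  have e : wr (P ^ 2) = (C 2 * P * ng P) * wr P := by
    unfold wr
    rw [ng_pow]
    simp only [derivative_pow]
    simp
    ring
  rw [e] at h
  have hco : IsCoprime (X ^ n) (C 2 * P * ng P) := by
    apply IsCoprime.pow_left
    rw [Polynomial.prime_X.irreducible.coprime_iff_not_dvd, X_dvd_iff,
      coeff_zero_eq_eval_zero]
    simp [ng_eval, hP, h2]
  exact hco.dvd_of_dvd_mul_left h

lemma wr_degree (c : F[X]) (n : ℕ) (hn : 2 * c.natDegree ≤ n) (hc : c.natDegree ≠ 0)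
    (h : X ^ n ∣ wr c) : wr c = 0 := by
  by_contra h0
  have h1 := natDegree_le_of_dvd h h0
  have h2 : (wr c).natDegree ≤ 2 * c.natDegree - 1 := by
    unfold wr
    have a1 := natDegree_derivative_le c
    have a2 := natDegree_derivative_le (ng c)
    rw [ng_natDegree] at a2
    refine (natDegree_sub_le _ _).trans (max_le ?_ ?_)
    · refine natDegree_mul_le.trans ?_
      rw [ng_natDegree]; omega
    · refine natDegree_mul_le.trans ?_
      omega
  rw [natDegree_X_pow] at h1
  omega

lemma not_dvd_ng (c : F[X]) (hm : c.Monic) (h0 : c.eval 0 ≠ 0)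
    (hne : ng c ≠ c) : ¬ c ∣ ng c := by
  intro h
  have hc0 : c ≠ 0 := hm.ne_zero
  obtain ⟨k, hk⟩ := h
  have hng : ng c ≠ 0 := by
    intro h; apply hc0; rw [← ng_ng c, h]; simp [ng]
  have hk0 : k ≠ 0 := by rintro rfl; simp at hk; exact hng hk
  have hd := congrArg natDegree hk
  rw [natDegree_mul hc0 hk0, ng_natDegree] at hd
  have hkd : k.natDegree = 0 := by omega
  obtain ⟨a, rfl⟩ := natDegree_eq_zero.mp hkd
  have he := congrArg (eval 0) hk
  rw [ng_eval, eval_mul, eval_C] at he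
  have : a = 1 := by
    apply mul_left_cancel₀ h0; rw [← he]; ring
  subst this
  apply hne; simpa using hk

lemma wr_ne_zero [Finite F] (c : F[X]) (hm : c.Monic) (hi : Irreducible c)
    (h0 : c.eval 0 ≠ 0) (hne : ng c ≠ c) : wr c ≠ 0 := by
  intro h
  unfold wr at h
  have h1 : c ∣ derivative c * ng c := ⟨_, sub_eq_zero.mp h⟩
  rcases hi.prime.dvd_or_dvd h1 with h | h
  · have hs := PerfectField.separable_of_irreducible hi
    have := hs.isUnit_of_dvd' dvd_rfl h
    exact hi.not_isUnit this
  · exact not_dvd_ng c hm h0 hne h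

end basics

/-- Non-even irreducible polynomials with small Wronskian. -/
def NE (F : Type*) [Field F] (d r : ℕ) : Set (Polynomial F) :=
  {c | c.Monic ∧ Irreducible c ∧ c.natDegree = r ∧ c.eval 0 ≠ 0 ∧ ng c ≠ c ∧ X ^ (d - 1) ∣ wr c}

/-- The power series `(c(x) - c(-x)) / (c(x) + c(-x))`. -/
noncomputable def tt {F : Type*} [Field F] (c : Polynomial F) : PowerSeries F :=
  ((c - ng c : F[X]) : PowerSeries F) * ((c + ng c : F[X]) : PowerSeries F)⁻¹

section ne
variable {F : Type*} [Field F]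

lemma NE_empty [Finite F] {d r : ℕ} (h : 2 * r < d) : NE F d r = ∅ := by
  ext c
  simp only [Set.mem_empty_iff_false, iff_false]
  rintro ⟨hm, hi, hd, h0, hne, hw⟩
  refine wr_ne_zero c hm hi h0 hne (wr_degree c (d - 1) (by omega) ?_ hw)
  exact hi.natDegree_pos.ne'

lemma v_const (h2 : (2 : F) ≠ 0) (c : F[X]) (h0 : c.eval 0 ≠ 0) :
    PowerSeries.constantCoeff ((c + ng c : F[X]) : PowerSeries F) ≠ 0 := by
  rw [← PowerSeries.coeff_zero_eq_constantCoeff_apply, coeff_coe, coeff_add, ng_coeff,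
    coeff_zero_eq_eval_zero]
  simpa [← two_mul] using ⟨h2, h0⟩

lemma tt_mul (h2 : (2 : F) ≠ 0) (c : F[X]) (h0 : c.eval 0 ≠ 0) :
    tt c * ((c + ng c : F[X]) : PowerSeries F) = ((c - ng c : F[X]) : PowerSeries F) := by
  unfold tt
  rw [mul_assoc, PowerSeries.inv_mul_cancel _ (v_const h2 c h0), mul_one]

lemma v_unit (h2 : (2 : F) ≠ 0) (c : F[X]) (h0 : c.eval 0 ≠ 0) :
    IsUnit ((c + ng c : F[X]) : PowerSeries F) := by
  rw [PowerSeries.isUnit_iff_constantCoeff]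
  exact (v_const h2 c h0).isUnit

lemma rescale_coe (a : F[X]) :
    PowerSeries.rescale (-1 : F) (a : PowerSeries F) = ((ng a : F[X]) : PowerSeries F) := by
  ext n
  rw [PowerSeries.coeff_rescale, coeff_coe, coeff_coe, ng_coeff]

lemma tt_even (h2 : (2 : F) ≠ 0) (c : F[X]) (h0 : c.eval 0 ≠ 0) (j : ℕ) (hj : Even j) :
    PowerSeries.coeff j (tt c) = 0 := by
  have h := congrArg (PowerSeries.rescale (-1 : F)) (tt_mul h2 c h0)
  rw [map_mul, rescale_coe, rescale_coe, ng_add, ng_sub, ng_ng, add_comm (ng c) c] at h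
  have h' : PowerSeries.rescale (-1 : F) (tt c) * ((c + ng c : F[X]) : PowerSeries F)
      = (- tt c) * ((c + ng c : F[X]) : PowerSeries F) := by
    rw [h, neg_mul, tt_mul h2 c h0, ← Polynomial.coe_neg, neg_sub]
  have h3 := (v_unit h2 c h0).mul_right_cancel h'
  have h4 := congrArg (PowerSeries.coeff j) h3
  rw [PowerSeries.coeff_rescale, hj.neg_one_pow, one_mul, map_neg] at h4
  have : (2 : F) * PowerSeries.coeff j (tt c) = 0 := by linear_combination h4
  simpa [h2] using this

lemma tt_nondvd (h2 : (2 : F) ≠ 0) {p d : ℕ} [CharP F p] (c : F[X]) (h0 : c.eval 0 ≠ 0)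
    (hw : X ^ (d - 1) ∣ wr c) (j : ℕ) (hj : ¬ p ∣ j) (hjd : j < d) :
    PowerSeries.coeff j (tt c) = 0 := by
  have h := tt_mul h2 c h0
  set u : F[X] := c - ng c with hu
  set v : F[X] := c + ng c with hv
  have hd := congrArg (PowerSeries.derivative F) h
  rw [Derivation.leibniz, PowerSeries.derivative_coe, PowerSeries.derivative_coe] at hd
  simp only [smul_eq_mul] at hd
  have hW : derivative u * v - u * derivative v = C 2 * wr c := by
    rw [hu, hv, wr]
    simp only [derivative_add, derivative_sub]
    rw [show (C (2 : F) : F[X]) = 2 from map_ofNat C 2]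
    ring
  have hW' : ((C 2 * wr c : F[X]) : PowerSeries F)
      = PowerSeries.derivative F (tt c) * ((v : PowerSeries F) * (v : PowerSeries F)) := by
    rw [← hW, Polynomial.coe_sub, Polynomial.coe_mul, Polynomial.coe_mul, ← hd, ← h]
    ring
  have hdv : (PowerSeries.X : PowerSeries F) ^ (d - 1) ∣ PowerSeries.derivative F (tt c) := by
    have : (PowerSeries.X : PowerSeries F) ^ (d - 1) ∣ ((C 2 * wr c : F[X]) : PowerSeries F) := by
      obtain ⟨k, hk⟩ := hw
      refine ⟨((C 2 * k : F[X]) : PowerSeries F), ?_⟩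
      rw [hk]
      push_cast
      ring
    rw [hW'] at this
    exact ((v_unit h2 c h0).mul (v_unit h2 c h0)).dvd_mul_right.mp this
  rw [PowerSeries.X_pow_dvd_iff] at hdv
  rcases j with _ | j
  · simp at hj
  · have := hdv j (by omega)
    rw [PowerSeries.coeff_derivative] at this
    rcases mul_eq_zero.mp this with h | h
    · exact h
    · exfalso; apply hj
      rw [← CharP.cast_eq_zero_iff F p]
      exact_mod_cast h

lemma fiber_dvd (h2 : (2 : F) ≠ 0) {d : ℕ} (c c0 : F[X]) (h : c.eval 0 ≠ 0) (h0 : c0.eval 0 ≠ 0)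
    (ht : ∀ j < d, PowerSeries.coeff j (tt c) = PowerSeries.coeff j (tt c0)) :
    X ^ d ∣ c * ng c0 - ng c * c0 := by
  have h1 : (PowerSeries.X : PowerSeries F) ^ d ∣ tt c - tt c0 := by
    rw [PowerSeries.X_pow_dvd_iff]
    intro m hm
    rw [map_sub, ht m hm, sub_self]
  have e1 := tt_mul h2 c h
  have e2 := tt_mul h2 c0 h0
  have e3 : ((C 2 * (c * ng c0 - ng c * c0) : F[X]) : PowerSeries F) =
      (tt c - tt c0) * (((c + ng c : F[X]) : PowerSeries F) * ((c0 + ng c0 : F[X]) : PowerSeries F)) := by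
    have : (C 2 * (c * ng c0 - ng c * c0) : F[X]) =
      (c - ng c) * (c0 + ng c0) - (c0 - ng c0) * (c + ng c) := by
      rw [show (C (2 : F) : F[X]) = 2 from map_ofNat C 2]; ring
    rw [this, Polynomial.coe_sub, Polynomial.coe_mul, Polynomial.coe_mul, ← e1, ← e2]
    ring
  have h4 : (PowerSeries.X : PowerSeries F) ^ d ∣
      ((C 2 * (c * ng c0 - ng c * c0) : F[X]) : PowerSeries F) := by
    rw [e3]; exact h1.mul_right _
  have h5 : X ^ d ∣ C 2 * (c * ng c0 - ng c * c0) := by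
    rw [Polynomial.X_pow_dvd_iff]
    rw [PowerSeries.X_pow_dvd_iff] at h4
    intro m hm
    rw [← coeff_coe]; exact h4 m hm
  have hu : IsUnit (C (2 : F)) := isUnit_C.mpr h2.isUnit
  exact hu.dvd_mul_left.mp h5

/-- odd multiples of `p` below `d` -/
def JJ (p d : ℕ) : Finset ℕ := (Finset.range d).filter (fun j => Odd j ∧ p ∣ j)
/-- odd numbers in `[d, 2r)` -/
def KK (d r : ℕ) : Finset ℕ := (Finset.range (2 * r)).filter (fun j => Odd j ∧ d ≤ j)

lemma card_JJ {p : ℕ} (hp : 0 < p) (d : ℕ) : (JJ p d).card ≤ (d + p) / (2 * p) := by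
  have : (JJ p d) ⊆ (Finset.range ((d + p) / (2 * p))).image (fun i => p * (2 * i + 1)) := by
    intro j hj
    simp only [JJ, Finset.mem_filter, Finset.mem_range] at hj
    obtain ⟨hjd, hodd, k, rfl⟩ := hj
    obtain ⟨i, rfl⟩ := (Nat.odd_mul.mp hodd).2
    simp only [Finset.mem_image, Finset.mem_range]
    refine ⟨i, ?_, rfl⟩
    rw [← Nat.succ_le_iff, Nat.le_div_iff_mul_le (by positivity)]
    nlinarith
  exact (Finset.card_le_card this).trans (Finset.card_image_le.trans (by simp))

lemma card_KK {d r : ℕ} (hd : Odd d) : (KK d r).card ≤ r - (d - 1) / 2 := by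
  have : KK d r ⊆ (Finset.range (r - (d - 1) / 2)).image (fun i => d + 2 * i) := by
    intro j hj
    simp only [KK, Finset.mem_filter, Finset.mem_range] at hj
    obtain ⟨h1, ⟨k, rfl⟩, h3⟩ := hj
    obtain ⟨l, rfl⟩ := hd
    simp only [Finset.mem_image, Finset.mem_range]
    exact ⟨k - l, by omega, by omega⟩
  exact (Finset.card_le_card this).trans (Finset.card_image_le.trans (by simp))

lemma monic_finite [Finite F] (n : ℕ) : {c : F[X] | c.natDegree ≤ n}.Finite := by
  have : Finite (degreeLT F (n + 1)) := (degreeLTEquiv F (n+1)).toEquiv.finite_iff.mpr inferInstance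
  refine (Set.toFinite (degreeLT F (n + 1) : Set F[X])).subset ?_
  intro c hc
  have hc : c.natDegree ≤ n := hc
  simp only [SetLike.mem_coe, mem_degreeLT]
  exact lt_of_le_of_lt (degree_le_of_natDegree_le hc) (by exact_mod_cast Nat.lt_succ_self n)

lemma NE_finite [Finite F] (d r : ℕ) : (NE F d r).Finite :=
  (monic_finite r).subset (fun _ hc => hc.2.2.1.le)

lemma delta_inj {r : ℕ} (c0 c c' : F[X]) (m0 : c0.Monic) (i0 : Irreducible c0) (hd0 : c0.natDegree = r)
    (e0 : c0.eval 0 ≠ 0) (n0 : ng c0 ≠ c0) (m1 : c.Monic) (hd1 : c.natDegree = r)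
    (m2 : c'.Monic) (hd2 : c'.natDegree = r)
    (h : c * ng c0 - ng c * c0 = c' * ng c0 - ng c' * c0) : c = c' := by
  by_contra hne
  have hw : (c - c') ≠ 0 := sub_ne_zero.mpr hne
  have h1 : c0 ∣ (c - c') * ng c0 := ⟨ng c - ng c', by linear_combination h⟩
  rcases i0.prime.dvd_or_dvd h1 with h | h
  · have l1 := degree_le_of_dvd h hw
    have l2 := degree_sub_lt_left (p := c) (q := c') (by rw [degree_eq_natDegree m1.ne_zero, degree_eq_natDegree m2.ne_zero, hd1, hd2]) m1.ne_zero
      (by rw [m1.leadingCoeff, m2.leadingCoeff])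
    rw [degree_eq_natDegree m1.ne_zero, hd1] at l2
    rw [degree_eq_natDegree m0.ne_zero, hd0] at l1
    exact absurd l2 (not_lt.mpr l1)
  · exact not_dvd_ng c0 m0 e0 n0 h

lemma delta_coeff_even (c c0 : F[X]) (h2 : (2 : F) ≠ 0) (j : ℕ) (hj : Even j) :
    (c * ng c0 - ng c * c0).coeff j = 0 := by
  have h : ng (c * ng c0 - ng c * c0) = -(c * ng c0 - ng c * c0) := by
    rw [ng_sub, ng_mul, ng_mul, ng_ng, ng_ng]; ring
  have h4 := congrArg (fun f => coeff f j) h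
  simp only [ng_coeff, hj.neg_one_pow, coeff_neg, one_mul] at h4
  have : (2 : F) * (c * ng c0 - ng c * c0).coeff j = 0 := by linear_combination h4
  simpa [h2] using this

lemma delta_coeff_big (c c0 : F[X]) {r : ℕ} (h2 : (2 : F) ≠ 0) (hc : c.natDegree = r) (hc0 : c0.natDegree = r)
    (j : ℕ) (hj : 2 * r ≤ j) :
    (c * ng c0 - ng c * c0).coeff j = 0 := by
  rcases hj.eq_or_lt with rfl | hj
  · exact delta_coeff_even c c0 h2 _ (even_two_mul r)
  · apply coeff_eq_zero_of_natDegree_lt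
    refine lt_of_le_of_lt ?_ hj
    refine (natDegree_sub_le _ _).trans (max_le ?_ ?_) <;>
    · refine natDegree_mul_le.trans ?_
      rw [ng_natDegree]; omega

lemma NE_card [Fintype F] (h2 : (2 : F) ≠ 0) {p d r : ℕ} [CharP F p] (hp : 0 < p) (hd : Odd d) :
    (NE F d r).ncard ≤ Fintype.card F ^ (r - (d - 1) / 2) * Fintype.card F ^ ((d + p) / (2 * p)) := by
  classical
  have hq : 0 < Fintype.card F := Fintype.card_pos
  rw [Set.ncard_eq_toFinset_card _ (NE_finite d r)]
  set S := (NE_finite (F := F) d r).toFinset with hS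
  have hmem : ∀ c, c ∈ S ↔ c ∈ NE F d r := fun c => by simp [hS]
  let Φ : F[X] → (JJ p d → F) := fun c j => PowerSeries.coeff j.1 (tt c)
  have key : ∀ b ∈ (Finset.univ : Finset (JJ p d → F)), (S.filter (fun c => Φ c = b)).card
      ≤ Fintype.card F ^ (r - (d - 1) / 2) := by
    intro b _
    rcases (S.filter (fun c => Φ c = b)).eq_empty_or_nonempty with h | ⟨c0, h0⟩
    · rw [h]; simp
    rw [Finset.mem_filter, hmem] at h0
    obtain ⟨⟨m0, i0, hd0, e0, n0, w0⟩, hb0⟩ := h0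
    have hfib : ∀ c ∈ S.filter (fun c => Φ c = b), X ^ d ∣ c * ng c0 - ng c * c0 := by
      intro c hc
      rw [Finset.mem_filter, hmem] at hc
      obtain ⟨⟨m1, i1, hd1, e1, n1, w1⟩, hb1⟩ := hc
      apply fiber_dvd h2 c c0 e1 e0
      intro j hj
      by_cases hjo : Odd j
      · by_cases hpj : p ∣ j
        · have hJ : j ∈ JJ p d := by simp [JJ, hj, hjo, hpj]
          exact congrFun (hb1.trans hb0.symm) ⟨j, hJ⟩
        · rw [tt_nondvd h2 c e1 w1 j hpj hj, tt_nondvd h2 c0 e0 w0 j hpj hj]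
      · rw [Nat.not_odd_iff_even] at hjo
        rw [tt_even h2 c e1 j hjo, tt_even h2 c0 e0 j hjo]
    let Ψ : F[X] → (KK d r → F) := fun c j => (c * ng c0 - ng c * c0).coeff j.1
    have hinj : Set.InjOn Ψ (S.filter (fun c => Φ c = b)) := by
      intro c hc c' hc' hcc
      have hx := hfib c hc
      have hx' := hfib c' hc'
      rw [Finset.mem_coe, Finset.mem_filter, hmem] at hc hc'
      obtain ⟨⟨m1, i1, hd1, e1, n1, w1⟩, hb1⟩ := hc
      obtain ⟨⟨m2, i2, hd2', e2, n2, w2⟩, hb2⟩ := hc'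
      apply delta_inj c0 c c' m0 i0 hd0 e0 n0 m1 hd1 m2 hd2'
      ext j
      by_cases hjo : Even j
      · rw [delta_coeff_even c c0 h2 j hjo, delta_coeff_even c' c0 h2 j hjo]
      by_cases hjr : 2 * r ≤ j
      · rw [delta_coeff_big c c0 h2 hd1 hd0 j hjr, delta_coeff_big c' c0 h2 hd2' hd0 j hjr]
      by_cases hjd : j < d
      · rw [Polynomial.X_pow_dvd_iff.mp hx j hjd, Polynomial.X_pow_dvd_iff.mp hx' j hjd]
      rw [Nat.not_even_iff_odd] at hjo
      push Not at hjr hjd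
      have hK : j ∈ KK d r := by simp [KK, hjr, hjo, hjd]
      exact congrFun hcc ⟨j, hK⟩
    have := Finset.card_le_card_of_injOn Ψ (t := Finset.univ) (fun _ _ => Finset.mem_univ _) hinj
    refine this.trans ?_
    rw [Finset.card_univ, Fintype.card_fun, Fintype.card_coe]
    exact Nat.pow_le_pow_right hq (card_KK hd)
  have := Finset.card_le_mul_card_image_of_maps_to (s := S) (f := Φ) (t := Finset.univ)
    (fun _ _ => Finset.mem_univ _) _ key
  refine this.trans ?_
  rw [Finset.card_univ, Fintype.card_fun, Fintype.card_coe]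
  exact Nat.mul_le_mul_left _ (Nat.pow_le_pow_right hq (card_JJ hp d))

lemma NE_real [Fintype F] (h2 : (2 : F) ≠ 0) {p d r R : ℕ} [CharP F p] (hp : 0 < p) (hd : Odd d)
    (hrR : r ≤ R) :
    ((NE F d r).ncard : ℝ) ≤ (Fintype.card F : ℝ) ^
      ((R : ℝ) - (1 / 2 - 1 / (2 * (p : ℝ))) * (d : ℝ) + 3) := by
  have hq : (1 : ℝ) ≤ Fintype.card F := by exact_mod_cast (Fintype.card_pos (α := F))
  by_cases h : 2 * r < d
  · rw [NE_empty h]; simp; positivity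
  push Not at h
  have h1 : ((NE F d r).ncard : ℝ) ≤ (Fintype.card F : ℝ) ^ (r - (d - 1) / 2) *
      (Fintype.card F : ℝ) ^ ((d + p) / (2 * p)) := by exact_mod_cast NE_card h2 hp hd
  refine h1.trans ?_
  rw [← pow_add, ← Real.rpow_natCast]
  apply Real.rpow_le_rpow_of_exponent_le hq
  obtain ⟨k, rfl⟩ := hd
  have e1 : (2 * k + 1 - 1) / 2 = k := by omega
  rw [e1, Nat.cast_add, Nat.cast_sub (by omega)]
  have e2 : (((2 * k + 1 + p) / (2 * p) : ℕ) : ℝ) ≤ ((2 * k + 1 + p : ℕ) : ℝ) / ((2 * p : ℕ) : ℝ) :=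
    Nat.cast_div_le
  have hp' : (0 : ℝ) < p := by exact_mod_cast hp
  have e3 : ((2 * k + 1 + p : ℕ) : ℝ) / ((2 * p : ℕ) : ℝ) = 1 / (2 * (p : ℝ)) * (2 * k + 1) + 1 / 2 := by
    push_cast; field_simp
  have e4 : (r : ℝ) ≤ R := by exact_mod_cast hrR
  push_cast
  linarith

end ne

/-- Monic polynomials of degree at most `r / 3`. -/
def LL (F : Type*) [Field F] (r : ℕ) : Set (Polynomial F) :=
  {f | f.Monic ∧ 3 * f.natDegree ≤ r}

/-- Even monic irreducible polynomials of degree `r`. -/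
def EV (F : Type*) [Field F] (r : ℕ) : Set (Polynomial F) :=
  {c | c.Monic ∧ Irreducible c ∧ c.natDegree = r ∧ ng c = c}

section ev
variable {F : Type*} [Field F]

lemma LL_finite [Finite F] (r : ℕ) : (LL F r).Finite :=
  (monic_finite r).subset (fun f hf => by
    have := hf.2
    show f.natDegree ≤ r
    omega)

lemma EV_finite [Finite F] (r : ℕ) : (EV F r).Finite :=
  (monic_finite r).subset (fun _ hf => hf.2.2.1.le)

lemma LL_card [Fintype F] (r : ℕ) : (LL F r).ncard ≤ 2 * Fintype.card F ^ (r / 3) := by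
  classical
  have hq : 1 < Fintype.card F := Fintype.one_lt_card
  rw [Set.ncard_eq_toFinset_card _ (LL_finite r)]
  set S := (LL_finite (F := F) r).toFinset with hS
  have hmem : ∀ c, c ∈ S ↔ c ∈ LL F r := fun c => by simp [hS]
  let Ψ : Fˣ × F[X] → (Fin (r / 3 + 1) → F) := fun x j => (C (x.1 : F) * x.2).coeff j
  have hinj : Set.InjOn Ψ ((Finset.univ ×ˢ S : Finset (Fˣ × F[X])) : Set (Fˣ × F[X])) := by
    rintro ⟨a, f⟩ hf ⟨b, g⟩ hg h
    simp only [Finset.coe_product, Set.mem_prod, Finset.mem_coe, hmem] at hf hg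
    obtain ⟨-, hf, hf'⟩ := hf
    obtain ⟨-, hg, hg'⟩ := hg
    change f.Monic at hf
    change g.Monic at hg
    change 3 * f.natDegree ≤ r at hf'
    change 3 * g.natDegree ≤ r at hg'
    have e : C (a : F) * f = C (b : F) * g := by
      ext j
      by_cases hj : j < r / 3 + 1
      · exact congrFun h ⟨j, hj⟩
      · rw [coeff_C_mul, coeff_C_mul, coeff_eq_zero_of_natDegree_lt (p := f) (by omega),
          coeff_eq_zero_of_natDegree_lt (p := g) (by omega)]
        simp
    have e1 := congrArg leadingCoeff e
    rw [leadingCoeff_mul, leadingCoeff_mul, leadingCoeff_C, leadingCoeff_C, hf.leadingCoeff,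
      hg.leadingCoeff, mul_one, mul_one] at e1
    have e2 : a = b := Units.ext e1
    subst e2
    have : f = g := mul_left_cancel₀ (by simp) e
    rw [this]
  have := Finset.card_le_card_of_injOn Ψ (t := Finset.univ) (fun _ _ => Finset.mem_univ _) hinj
  rw [Finset.card_product, Finset.card_univ, Finset.card_univ, Fintype.card_fun, Fintype.card_fin,
    Fintype.card_units, pow_succ] at this
  obtain ⟨k, hk⟩ : ∃ k, Fintype.card F = k + 2 := ⟨_, (Nat.sub_add_cancel hq).symm⟩
  rw [hk] at this ⊢
  have h1 : k + 2 - 1 = k + 1 := rfl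
  rw [h1] at this
  have h2 : (k + 1) * S.card ≤ (k + 1) * (2 * (k + 2) ^ (r / 3)) := by
    refine this.trans ?_
    have : 0 ≤ (k + 2) ^ (r / 3) := Nat.zero_le _
    nlinarith
  exact Nat.le_of_mul_le_mul_left h2 (by omega)

lemma LL_real [Fintype F] (r : ℕ) :
    ((LL F r).ncard : ℝ) ≤ 2 * (Fintype.card F : ℝ) ^ ((r : ℝ) / 3) := by
  have hq : (1 : ℝ) ≤ Fintype.card F := by exact_mod_cast (Fintype.card_pos (α := F))
  have h1 : ((LL F r).ncard : ℝ) ≤ 2 * (Fintype.card F : ℝ) ^ (r / 3) := by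
    exact_mod_cast LL_card r
  refine h1.trans ?_
  rw [← Real.rpow_natCast]
  have := Real.rpow_le_rpow_of_exponent_le hq (Nat.cast_div_le (m := r) (n := 3) (α := ℝ))
  push_cast at this
  linarith

lemma even_expand (h2 : (2 : F) ≠ 0) (c : F[X]) (h : ng c = c) : ∃ f : F[X], c = expand F 2 f := by
  refine ⟨contract 2 c, ?_⟩
  ext j
  rw [coeff_expand (by norm_num)]
  split_ifs with hj
  · obtain ⟨k, rfl⟩ := hj
    rw [coeff_contract (by norm_num)]
    congr 1; omega
  · have h4 := congrArg (fun f => coeff f j) h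
    have hjo : Odd j := by rw [← Nat.not_even_iff_odd, even_iff_two_dvd]; exact hj
    simp only [ng_coeff, hjo.neg_one_pow] at h4
    have : (2 : F) * c.coeff j = 0 := by linear_combination -h4
    simpa [h2] using this

lemma ng_expand (f : F[X]) : ng (expand F 2 f) = expand F 2 f := by
  simp [ng, expand_eq_comp_X_pow, comp_assoc]

lemma expand_monic {f : F[X]} (h : (expand F 2 f).Monic) : f.Monic := by
  rwa [monic_expand_iff (by norm_num)] at h

lemma EV_odd (h2 : (2 : F) ≠ 0) {r : ℕ} (hr : ¬ 2 ∣ r) : EV F r = ∅ := by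
  ext c
  simp only [Set.mem_empty_iff_false, iff_false]
  rintro ⟨hm, hi, hd, he⟩
  obtain ⟨f, rfl⟩ := even_expand h2 c he
  rw [natDegree_expand] at hd
  exact hr ⟨_, by rw [← hd, mul_comm]⟩

/-- `x^{q^m} + x` -/
noncomputable def GG (F : Type*) [Field F] (m : ℕ) : F[X] := X ^ (Nat.card F ^ m) + X

lemma GG_natDegree [Finite F] {m : ℕ} (hm : 0 < m) : (GG F m).natDegree = Nat.card F ^ m := by
  unfold GG
  rw [natDegree_add_eq_left_of_natDegree_lt]
  · simp
  · rw [natDegree_X_pow, natDegree_X]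
    exact Nat.one_lt_pow hm.ne' Finite.one_lt_card

lemma GG_monic [Finite F] {m : ℕ} (hm : 0 < m) : (GG F m).Monic := by
  unfold GG
  apply monic_X_pow_add
  rw [degree_X]
  exact_mod_cast Nat.one_lt_pow hm.ne' Finite.one_lt_card

lemma GG_sqf [Finite F] {m : ℕ} (hm : 0 < m) : Squarefree (GG F m) := by
  apply Separable.squarefree
  have : derivative (GG F m) = 1 := by
    unfold GG
    rw [derivative_add, derivative_X_pow, derivative_X]
    have : ((Nat.card F ^ m : ℕ) : F) = 0 := by
      have := Fintype.ofFinite F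
      rw [Nat.cast_pow, Nat.card_eq_fintype_card, FiniteField.cast_card_eq_zero, zero_pow hm.ne']
    rw [this]; simp
  rw [Polynomial.Separable, this]
  exact isCoprime_one_right

lemma pow_card_pow_expand [Finite F] (f : F[X]) (m : ℕ) : f ^ (Nat.card F ^ m) = f.comp (X ^ (Nat.card F ^ m)) := by
  have := Fintype.ofFinite F
  rw [← expand_eq_comp_X_pow]
  induction m with
  | zero => simp
  | succ m ih =>
    rw [pow_succ, pow_mul, ih, expand_mul, Nat.card_eq_fintype_card, ← map_pow,
      FiniteField.expand_card]

lemma GG_dvd_even [Finite F] {m : ℕ} (h2 : (2 : F) ≠ 0) {P : F[X]} (hP : P ∈ EV F (2 * m)) (hm : 0 < m) :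
    P ∣ GG F m := by
  obtain ⟨hmo, hi, hd, he⟩ := hP
  obtain ⟨f, rfl⟩ := even_expand h2 P he
  have hfi : Irreducible f := of_irreducible_expand (by norm_num) hi
  rw [natDegree_expand] at hd
  have h1 : f ∣ X ^ (Nat.card F) ^ m - X :=
    hfi.natDegree_dvd_iff_dvd_X_pow_card_pow_sub_X.mp (by
      rw [show f.natDegree = m by omega])
  have h3 := map_dvd (expand F 2) h1
  have h4 : expand F 2 (X ^ (Nat.card F) ^ m - X) = (X ^ (Nat.card F) ^ m - X) * GG F m := by
    simp [GG, expand_X]; ring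
  rw [h4] at h3
  rcases hi.prime.dvd_or_dvd h3 with h | h
  · have := hi.natDegree_dvd_of_dvd_X_pow_card_pow_sub_X h
    rw [natDegree_expand, hd] at this
    have := Nat.le_of_dvd hm this
    omega
  · exact h

lemma even_of_GG_dvd [Finite F] {m : ℕ} {P : F[X]} (hmo : P.Monic) (hi : Irreducible P)
    (hd : P.natDegree = 2 * m) (hm : 0 < m) (h : P ∣ GG F m) : P ∈ EV F (2 * m) := by
  refine ⟨hmo, hi, hd, ?_⟩
  by_contra hne
  have h0 : P.eval 0 ≠ 0 := by
    intro h0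
    have hX : X ∣ P := by rw [X_dvd_iff, coeff_zero_eq_eval_zero, h0]
    have := (Polynomial.irreducible_X.associated_of_dvd hi hX)
    have := natDegree_eq_of_degree_eq (degree_eq_degree_of_associated this)
    rw [natDegree_X] at this
    omega
  apply not_dvd_ng P hmo h0 hne
  have h1 : P ∣ P.comp (X ^ (Nat.card F ^ m)) := by
    rw [← pow_card_pow_expand]
    exact dvd_pow_self _ (pow_pos Nat.card_pos _).ne'
  have h3 : GG F m ∣ P.comp (X ^ (Nat.card F ^ m)) - ng P := by
    have := Polynomial.sub_dvd_eval_sub (X ^ (Nat.card F ^ m)) (-X : F[X]) (P.map C)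
    simp only [eval_map] at this
    unfold ng
    rw [sub_neg_eq_add] at this
    exact this
  exact (dvd_sub_right h1).mp (h.trans h3)

lemma GG_factor [Finite F] {m : ℕ} (h2 : (2 : F) ≠ 0) {P : F[X]} (hmo : P.Monic) (hi : Irreducible P)
    (hm : 0 < m) (h : P ∣ GG F m) : P ∈ EV F (2 * m) ∨ P ∈ LL F (2 * m) ∨ P = X := by
  have h1 : P ∣ X ^ (Nat.card F) ^ (2 * m) - X := by
    have e : (X ^ (Nat.card F) ^ (2 * m) - X : F[X]) = GG F m ^ (Nat.card F ^ m) - GG F m := by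
      rw [pow_card_pow_expand (GG F m)]
      unfold GG
      rw [add_comp, X_comp, pow_comp, X_comp, ← pow_mul, ← pow_add, two_mul]
      ring
    rw [e]
    exact dvd_sub (h.trans (dvd_pow_self _ (pow_pos Nat.card_pos _).ne')) h
  obtain ⟨j, hj⟩ := hi.natDegree_dvd_of_dvd_X_pow_card_pow_sub_X h1
  by_cases hs : P.natDegree ∣ m
  · right; right
    have h3 := hi.natDegree_dvd_iff_dvd_X_pow_card_pow_sub_X.mp hs
    have h4 : P ∣ C 2 * X := by
      have := dvd_sub h h3
      have e : GG F m - (X ^ (Nat.card F) ^ m - X) = C 2 * X := by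
        rw [show (C (2 : F) : F[X]) = 2 from map_ofNat C 2]; unfold GG; ring
      rwa [e] at this
    have hu : IsUnit (C (2 : F)) := isUnit_C.mpr h2.isUnit
    have h5 : P ∣ X := hu.dvd_mul_left.mp h4
    exact eq_of_monic_of_associated hmo monic_X (hi.associated_of_dvd irreducible_X h5)
  · have hj0 : j ≠ 0 := by rintro rfl; omega
    have hj2 : j ≠ 2 := by
      rintro rfl
      exact hs ⟨1, by omega⟩
    by_cases hj1 : j = 1
    · left; exact even_of_GG_dvd hmo hi (by rw [hj, hj1, mul_one]) hm h
    · right; left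
      refine ⟨hmo, ?_⟩
      rw [hj]
      have : 3 ≤ j := by omega
      nlinarith

lemma EV_count [Fintype F] {m : ℕ} (h2 : (2 : F) ≠ 0) (hm : 0 < m) :
    (2 * m) * (EV F (2 * m)).ncard ≤ Fintype.card F ^ m ∧
    Fintype.card F ^ m ≤ (2 * m) * (EV F (2 * m)).ncard + (2 * m) * ((LL F (2 * m)).ncard + 1) := by
  classical
  have hG0 : GG F m ≠ 0 := (GG_monic hm).ne_zero
  set M := UniqueFactorizationMonoid.normalizedFactors (GG F m) with hM
  have hnd : M.Nodup := (UniqueFactorizationMonoid.squarefree_iff_nodup_normalizedFactors hG0).mp (GG_sqf hm)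
  have hmM : ∀ P ∈ M, P.Monic := by
    intro P hP
    have h1 := UniqueFactorizationMonoid.normalize_normalized_factor P hP
    have h3 := UniqueFactorizationMonoid.irreducible_of_normalized_factor P hP
    rw [← h1]; exact monic_normalize h3.ne_zero
  have hprod : M.prod = GG F m := by
    apply eq_of_monic_of_associated _ (GG_monic hm)
      (UniqueFactorizationMonoid.prod_normalizedFactors hG0)
    have := monic_multiset_prod_of_monic M id hmM
    simpa using this
  have hsum : ∑ P ∈ M.toFinset, P.natDegree = Fintype.card F ^ m := by
    rw [← Nat.card_eq_fintype_card, ← GG_natDegree hm, ← hprod,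
      natDegree_multiset_prod_of_monic _ hmM, Finset.sum, Multiset.toFinset_val, hnd.dedup]
  have hEV : (EV_finite (F := F) (2 * m)).toFinset ⊆ M.toFinset := by
    intro P hP
    rw [Set.Finite.mem_toFinset] at hP
    rw [Multiset.mem_toFinset]
    rw [UniqueFactorizationMonoid.mem_normalizedFactors_iff' hG0]
    exact ⟨hP.2.1, hP.1.normalize_eq_self, GG_dvd_even h2 hP hm⟩
  have hEVs : ∑ P ∈ (EV_finite (F := F) (2 * m)).toFinset, P.natDegree = 2 * m * (EV F (2 * m)).ncard := by
    rw [Set.ncard_eq_toFinset_card _ (EV_finite (2 * m)), mul_comm (2 * m), ← smul_eq_mul]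
    apply Finset.sum_eq_card_nsmul
    intro P hP
    rw [Set.Finite.mem_toFinset] at hP
    exact hP.2.2.1
  constructor
  · rw [← hsum, ← hEVs]
    exact Finset.sum_le_sum_of_subset hEV
  · rw [← hsum, ← hEVs, ← Finset.sum_sdiff hEV, add_comm]
    apply Nat.add_le_add_left
    have hsub : M.toFinset \ (EV_finite (F := F) (2 * m)).toFinset ⊆
        insert X (LL_finite (F := F) (2 * m)).toFinset := by
      intro P hP
      rw [Finset.mem_sdiff, Multiset.mem_toFinset, Set.Finite.mem_toFinset] at hP
      rw [Finset.mem_insert, Set.Finite.mem_toFinset]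
      have := GG_factor h2 (hmM P hP.1) (UniqueFactorizationMonoid.irreducible_of_normalized_factor P hP.1)
        hm (UniqueFactorizationMonoid.dvd_of_mem_normalizedFactors hP.1)
      tauto
    refine (Finset.sum_le_sum_of_subset hsub).trans ?_
    refine (Finset.sum_le_card_nsmul _ _ (2 * m) ?_).trans ?_
    · intro P hP
      rw [Finset.mem_insert, Set.Finite.mem_toFinset] at hP
      rcases hP with rfl | hP
      · rw [natDegree_X]; omega
      · have := hP.2; omega
    · rw [smul_eq_mul, mul_comm, Set.ncard_eq_toFinset_card _ (LL_finite (2 * m))]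
      exact Nat.mul_le_mul_left _ (Finset.card_insert_le _ _)

lemma vM_le {c : F[X]} : vM c ≤ c.natDegree := by
  unfold vM
  apply csSup_le'
  rintro n ⟨P, k, hm, hi, hk, rfl, rfl⟩
  rw [natDegree_pow]
  exact Nat.le_mul_of_pos_left _ hk

lemma vM_irred {c : F[X]} (hm : c.Monic) (hi : Irreducible c) : vM c = c.natDegree := by
  apply le_antisymm vM_le
  unfold vM
  apply le_csSup
  · refine ⟨c.natDegree, ?_⟩
    rintro n ⟨P, k, hm, hi, hk, rfl, rfl⟩
    rw [natDegree_pow]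
    exact Nat.le_mul_of_pos_left _ hk
  · exact ⟨c, 1, hm, hi, le_rfl, by simp, rfl⟩

lemma vM_ne_zero {c : F[X]} (h : vM c ≠ 0) :
    ∃ (P : F[X]) (k : ℕ), P.Monic ∧ Irreducible P ∧ 1 ≤ k ∧ c = P ^ k := by
  by_contra hne
  apply h
  unfold vM
  have : {n : ℕ | ∃ (P : Polynomial F) (k : ℕ),
    P.Monic ∧ Irreducible P ∧ 1 ≤ k ∧ c = P ^ k ∧ n = P.natDegree} = ∅ := by
    ext n
    simp only [Set.mem_empty_iff_false, iff_false]
    rintro ⟨P, k, h1, h2, h3, h4, -⟩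
    exact hne ⟨P, k, h1, h2, h3, h4⟩
  rw [this]; simp

end ev

/-- The set summed over. -/
def SS (F : Type*) [Field F] (p : ℕ) (Q : F[X]) (r : ℕ) : Set F[X] :=
  {c : Polynomial F | c.Monic ∧ c.natDegree = r ∧
            ∃ a b : Polynomial F, a.eval 0 ≠ 0 ∧ b.eval 0 ≠ 0 ∧
              Q ∣ c - a.comp (X ^ 2) * b.comp (X ^ p)}

section fin
variable {F : Type*} [Field F]

lemma SS_finite [Finite F] (p : ℕ) (Q : F[X]) (r : ℕ) : (SS F p Q r).Finite :=
  (monic_finite r).subset (fun _ hf => hf.2.1.le)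

lemma EV_sub (h2 : (2 : F) ≠ 0) (p : ℕ) (Q : F[X]) (r : ℕ) : EV F r ⊆ SS F p Q r := by
  rintro c ⟨hm, hi, hd, he⟩
  obtain ⟨f, rfl⟩ := even_expand h2 c he
  refine ⟨hm, hd, f, 1, ?_, by simp, ?_⟩
  · intro h0
    have hX : X ∣ f := by rw [X_dvd_iff, coeff_zero_eq_eval_zero, h0]
    have h1 := map_dvd (expand F 2) hX
    rw [expand_X] at h1
    have hfi : Irreducible f := of_irreducible_expand (by norm_num) hi
    have h3 : X ∣ expand F 2 f := (dvd_pow_self X (by norm_num)).trans h1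
    have h4 := natDegree_eq_of_degree_eq
      (degree_eq_degree_of_associated (irreducible_X.associated_of_dvd hi h3))
    rw [natDegree_X, natDegree_expand] at h4
    omega
  · rw [expand_eq_comp_X_pow]; simp

lemma SS_cover (h2 : (2 : F) ≠ 0) {p d r : ℕ} [CharP F p] (hp : 0 < p) (hd : 1 ≤ d) {Q : F[X]}
    (hQ : X ^ d ∣ Q) {c : F[X]} (hc : c ∈ SS F p Q r) (hv : vM c ≠ 0) :
    c ∈ EV F r ∪ (NE F d r ∪ (Set.image (fun P => P ^ 2) (NE F d (r / 2)) ∪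
      (Set.image (fun f => (expand F 2 f) ^ 2) (LL F r) ∪ Set.image (fun P => P ^ (r / P.natDegree)) (LL F r)))) := by
  obtain ⟨P, k, hPm, hPi, hk, rfl⟩ := vM_ne_zero hv
  obtain ⟨hm, hdeg, a, b, ha, hb, hab⟩ := hc
  have hdv := hQ.trans hab
  have hw := wr_dvd (p := p) (P ^ k) a b hdv
  have h0 : P.eval 0 ≠ 0 := by
    intro h0
    have h1 : X ∣ P ^ k - a.comp (X ^ 2) * b.comp (X ^ p) :=
      (dvd_pow_self X (by omega)).trans hdv
    rw [X_dvd_iff, coeff_zero_eq_eval_zero] at h1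
    simp [h0, hp.ne', (show k ≠ 0 by omega), ha, hb] at h1
  rw [natDegree_pow] at hdeg
  have hPd := hPi.natDegree_pos
  rcases (show k = 1 ∨ k = 2 ∨ 3 ≤ k by omega) with rfl | rfl | hk3
  · rw [pow_one] at hw ⊢
    rw [one_mul] at hdeg
    by_cases he : ng P = P
    · left; exact ⟨hPm, hPi, hdeg, he⟩
    · right; left; exact ⟨hPm, hPi, hdeg, h0, he, hw⟩
  · have hw' := wr_sq h2 P h0 hw
    by_cases he : ng P = P
    · right; right; right; left
      obtain ⟨f, rfl⟩ := even_expand h2 P he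
      refine ⟨f, ⟨expand_monic hPm, ?_⟩, rfl⟩
      rw [natDegree_expand] at hdeg
      omega
    · right; right; left
      exact ⟨P, ⟨hPm, hPi, by omega, h0, he, hw'⟩, rfl⟩
  · right; right; right; right
    refine ⟨P, ⟨hPm, ?_⟩, ?_⟩
    · rw [← hdeg]; exact Nat.mul_le_mul_right _ hk3
    · simp only
      rw [← hdeg, Nat.mul_div_cancel _ hPd]

lemma SS_sum [Fintype F] (h2 : (2 : F) ≠ 0) {p d r : ℕ} [CharP F p] (hp : 0 < p) (hd : 1 ≤ d) {Q : F[X]}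
    (hQ : X ^ d ∣ Q) :
    r * (EV F r).ncard ≤ ∑ᶠ c ∈ SS F p Q r, vM c ∧
    ∑ᶠ c ∈ SS F p Q r, vM c ≤ r * ((EV F r).ncard + ((NE F d r).ncard + ((NE F d (r / 2)).ncard +
      ((LL F r).ncard + (LL F r).ncard)))) := by
  classical
  rw [finsum_mem_eq_finite_toFinset_sum _ (SS_finite p Q r)]
  constructor
  · have h : ∑ c ∈ (EV_finite (F := F) r).toFinset, vM c = r * (EV F r).ncard := by
      rw [Set.ncard_eq_toFinset_card _ (EV_finite r), mul_comm, ← smul_eq_mul]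
      apply Finset.sum_eq_card_nsmul
      intro c hc
      rw [Set.Finite.mem_toFinset] at hc
      rw [vM_irred hc.1 hc.2.1, hc.2.2.1]
    rw [← h]
    apply Finset.sum_le_sum_of_subset
    intro c hc
    rw [Set.Finite.mem_toFinset] at hc ⊢
    exact EV_sub h2 p Q r hc
  · rw [← Finset.sum_filter_ne_zero]
    refine (Finset.sum_le_card_nsmul _ _ r ?_).trans ?_
    · intro c hc
      rw [Finset.mem_filter, Set.Finite.mem_toFinset] at hc
      rw [← hc.1.2.1]; exact vM_le
    · rw [smul_eq_mul, mul_comm]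
      apply Nat.mul_le_mul_left
      have hsub : (((SS_finite p Q r).toFinset.filter (fun c => vM c ≠ 0) : Finset F[X]) : Set F[X]) ⊆
        EV F r ∪ (NE F d r ∪ (Set.image (fun P => P ^ 2) (NE F d (r / 2)) ∪
          (Set.image (fun f => (expand F 2 f) ^ 2) (LL F r) ∪ Set.image (fun P => P ^ (r / P.natDegree)) (LL F r)))) := by
        intro c hc
        rw [Finset.mem_coe, Finset.mem_filter, Set.Finite.mem_toFinset] at hc
        exact SS_cover h2 hp hd hQ hc.1 hc.2
      have hL := LL_finite (F := F) r
      rw [← Set.ncard_coe_finset]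
      refine (Set.ncard_le_ncard hsub ?_).trans ?_
      · exact (EV_finite r).union ((NE_finite d r).union (((NE_finite d (r / 2)).image _).union
          ((hL.image _).union (hL.image _))))
      · refine (Set.ncard_union_le _ _).trans (Nat.add_le_add_left ?_ _)
        refine (Set.ncard_union_le _ _).trans (Nat.add_le_add_left ?_ _)
        refine (Set.ncard_union_le _ _).trans (Nat.add_le_add (Set.ncard_image_le (NE_finite d _)) ?_)
        exact (Set.ncard_union_le _ _).trans
          (Nat.add_le_add (Set.ncard_image_le hL) (Set.ncard_image_le hL))

end fin

/-- There is an absolute constant `C > 0` such that for every prime `p > 2`, every finite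
field `F_q` of characteristic `p`, every odd `d ≥ 1` coprime with `p`, `Q = x^d` or
`x^{d+1}`, and every `r ≥ 1`: letting `A` (resp. `B`) be the subgroup of residues mod `Q` of
polynomials `u` with `u(0) ≠ 0` congruent mod `Q` to a polynomial in `F_q[x²]`
(resp. `F_q[x^p]`), one has
`|ψ(r; AB) − 1_{2∣r}·q^{r/2}| ≤ C·(r·q^{r/3+3ω} + r·q^{r−(1/2−1/(2p))d+3})`,
where `ω = 1` if `r > d/4 − 1` and `ω = 0` otherwise, and `ψ(r; N)` is the sum of `Λ(c)`
over monic `c` of degree `r` with `c mod Q ∈ N`. -/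
theorem stmt_15 : ∃ C : ℝ, 0 < C ∧
    ∀ (p : ℕ), p.Prime → 2 < p →
    ∀ (Fq : Type) [Field Fq] [Fintype Fq], CharP Fq p →
    ∀ (d : ℕ), 1 ≤ d → Odd d → Nat.Coprime d p →
    ∀ Q : Polynomial Fq, (Q = X ^ d ∨ Q = X ^ (d + 1)) →
    ∀ r : ℕ, 1 ≤ r →
      |((∑ᶠ c ∈ {c : Polynomial Fq | c.Monic ∧ c.natDegree = r ∧
            ∃ a b : Polynomial Fq, a.eval 0 ≠ 0 ∧ b.eval 0 ≠ 0 ∧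
              Q ∣ c - a.comp (X ^ 2) * b.comp (X ^ p)}, vM c : ℕ) : ℝ) -
          (if 2 ∣ r then (1 : ℝ) else 0) * (Fintype.card Fq : ℝ) ^ ((r : ℝ) / 2)| ≤
        C * ((r : ℝ) * (Fintype.card Fq : ℝ) ^
            ((r : ℝ) / 3 + 3 * (if (d : ℝ) / 4 - 1 < (r : ℝ) then (1 : ℝ) else 0)) +
          (r : ℝ) * (Fintype.card Fq : ℝ) ^
            ((r : ℝ) - (1 / 2 - 1 / (2 * (p : ℝ))) * (d : ℝ) + 3)) := by
  refine ⟨4, by norm_num, ?_⟩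
  intro p hp hp2 Fq _ _ hchar d hd hodd _ Q hQ r hr
  have h2 : (2 : Fq) ≠ 0 := by
    intro h
    have h' : ((2 : ℕ) : Fq) = 0 := by exact_mod_cast h
    rw [CharP.cast_eq_zero_iff Fq p] at h'
    exact absurd (Nat.le_of_dvd (by norm_num) h') (by omega)
  have hQ' : X ^ d ∣ Q := by
    rcases hQ with rfl | rfl
    · exact dvd_rfl
    · exact pow_dvd_pow _ (Nat.le_succ d)
  obtain ⟨hlo, hhi⟩ := SS_sum (r := r) h2 hp.pos hd hQ'
  change |((∑ᶠ c ∈ SS Fq p Q r, vM c : ℕ) : ℝ) - _| ≤ _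
  set ψ := ∑ᶠ c ∈ SS Fq p Q r, vM c with hψ
  have hq : (1 : ℝ) ≤ Fintype.card Fq := by exact_mod_cast (Fintype.card_pos (α := Fq))
  have hN1 := NE_real (F := Fq) h2 hp.pos hodd (le_refl r)
  have hN2 := NE_real (F := Fq) h2 hp.pos hodd (Nat.div_le_self r 2)
  have hL := LL_real (F := Fq) r
  have hA : (Fintype.card Fq : ℝ) ^ ((r : ℝ) / 3) ≤ (Fintype.card Fq : ℝ) ^
      ((r : ℝ) / 3 + 3 * (if (d : ℝ) / 4 - 1 < (r : ℝ) then (1 : ℝ) else 0)) := by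
    apply Real.rpow_le_rpow_of_exponent_le hq
    split_ifs <;> norm_num
  have hA1 : (1 : ℝ) ≤ (Fintype.card Fq : ℝ) ^ ((r : ℝ) / 3) :=
    Real.one_le_rpow hq (by positivity)
  set A := (Fintype.card Fq : ℝ) ^
      ((r : ℝ) / 3 + 3 * (if (d : ℝ) / 4 - 1 < (r : ℝ) then (1 : ℝ) else 0)) with hAdef
  set B := (Fintype.card Fq : ℝ) ^
      ((r : ℝ) - (1 / 2 - 1 / (2 * (p : ℝ))) * (d : ℝ) + 3) with hBdef
  have hB0 : 0 ≤ B := by positivity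
  have hlo' : (r : ℝ) * ((EV Fq r).ncard : ℝ) ≤ ψ := by exact_mod_cast hlo
  have hhi' : (ψ : ℝ) ≤ r * ((EV Fq r).ncard + ((NE Fq d r).ncard + ((NE Fq d (r / 2)).ncard +
      ((LL Fq r).ncard + (LL Fq r).ncard : ℝ)))) := by exact_mod_cast hhi
  have hr0 : (0 : ℝ) ≤ r := by positivity
  have hup : (ψ : ℝ) ≤ r * ((EV Fq r).ncard : ℝ) + r * (2 * B + 4 * A) := by
    refine hhi'.trans ?_
    rw [← mul_add]
    apply mul_le_mul_of_nonneg_left _ hr0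
    linarith
  have hrA : 0 ≤ (r : ℝ) * A := mul_nonneg hr0 (by linarith)
  have hrB : 0 ≤ (r : ℝ) * B := mul_nonneg hr0 hB0
  split_ifs with hr2
  · obtain ⟨m, rfl⟩ := hr2
    obtain ⟨c1, c2⟩ := EV_count (F := Fq) h2 (show 0 < m by omega)
    have e : (Fintype.card Fq : ℝ) ^ (((2 * m : ℕ) : ℝ) / 2) = (Fintype.card Fq : ℝ) ^ m := by
      rw [← Real.rpow_natCast]; congr 1; push_cast; ring
    rw [e, one_mul]
    have c1' : ((2 * m : ℕ) : ℝ) * ((EV Fq (2 * m)).ncard : ℝ) ≤ (Fintype.card Fq : ℝ) ^ m := by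
      exact_mod_cast c1
    have c2' : (Fintype.card Fq : ℝ) ^ m ≤ ((2 * m : ℕ) : ℝ) * ((EV Fq (2 * m)).ncard : ℝ) +
        ((2 * m : ℕ) : ℝ) * (((LL Fq (2 * m)).ncard : ℝ) + 1) := by
      exact_mod_cast c2
    have c3 : ((2 * m : ℕ) : ℝ) * (((LL Fq (2 * m)).ncard : ℝ) + 1) ≤ ((2 * m : ℕ) : ℝ) * (3 * A) :=
      mul_le_mul_of_nonneg_left (by linarith) hr0
    rw [abs_le]
    constructor <;> linarith
  · rw [EV_odd h2 hr2] at hup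
    simp only [Set.ncard_empty, Nat.cast_zero, mul_zero, zero_add] at hup
    rw [zero_mul, sub_zero, abs_of_nonneg (by positivity)]
    linarith
end

section
/- Let F_q be a finite field of characteristic p > 2 and let Q ∈ F_q[x] be a squarefree polynomial. Then for every integer r, the number of polynomials c ∈ F_q[x] with deg c ≤ r whose formal derivative c' is divisible by Q is at most q^{r/2 + (1/2 − 1/p)(r − 2·deg Q) + 2p} if deg Q < r < 2·deg Q, and at most q^{r/2 + (r − 2·deg Q)/2 + 2p} if r ≥ 2·deg Q. -/
open Polynomial

/-- `d` is the degree of a nonzero element of `V`. -/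
def DegIn {F : Type*} [Field F] (V : Submodule F F[X]) (d : ℕ) : Prop :=
  ∃ c ∈ V, c.degree = (d : WithBot ℕ)

open Classical in
lemma card_eq_pow_count {F : Type*} [Field F] [Fintype F] (V : Submodule F F[X]) (n : ℕ) :
    Nat.card {c : F[X] // c.degree < (n : WithBot ℕ) ∧ c ∈ V} =
      Fintype.card F ^ Nat.count (DegIn V) n := by
  induction n with
  | zero =>
    have : Unique {c : F[X] // c.degree < ((0 : ℕ) : WithBot ℕ) ∧ c ∈ V} :=
      { default := ⟨0, by simp, V.zero_mem⟩
        uniq := by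
          rintro ⟨c, hc, _⟩
          have : c = 0 := by
            rw [← Polynomial.degree_eq_bot]
            simpa [Nat.WithBot.lt_zero_iff] using hc
          simp [this] }
    rw [Nat.card_unique, Nat.count_zero, pow_zero]
  | succ n ih =>
    rw [Nat.count_succ]
    have key : ∀ c : F[X], c.degree < ((n+1 : ℕ) : WithBot ℕ) → c.coeff n = 0 →
        c.degree < (n : WithBot ℕ) := by
      intro c hc h0
      rw [Polynomial.degree_lt_iff_coeff_zero] at hc ⊢
      intro k hk
      rcases Nat.eq_or_lt_of_le hk with h | h
      · rw [← h]; exact h0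
      · exact hc k h
    have up : ∀ c : F[X], c.degree < (n : WithBot ℕ) → c.degree < ((n+1 : ℕ) : WithBot ℕ) :=
      fun c hc => hc.trans (by exact_mod_cast Nat.lt_succ_self n)
    by_cases hS : DegIn V n
    · rw [if_pos hS, pow_succ, ← ih]
      obtain ⟨s, hs, hsd⟩ := hS
      have hs0 : s.coeff n ≠ 0 := Polynomial.coeff_ne_zero_of_eq_degree hsd
      have hsd' : s.degree < ((n+1 : ℕ) : WithBot ℕ) := by
        rw [hsd]; exact_mod_cast Nat.lt_succ_self n
      rw [← Nat.card_eq_fintype_card (α := F), ← Nat.card_prod]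
      refine Nat.card_congr
        { toFun := fun c => (⟨c.1 - (c.1.coeff n / s.coeff n) • s, ?_, ?_⟩, c.1.coeff n)
          invFun := fun v => ⟨v.1.1 + (v.2 / s.coeff n) • s, ?_, ?_⟩
          left_inv := ?_
          right_inv := ?_ }
      · apply key
        · exact lt_of_le_of_lt (degree_sub_le _ _)
            (max_lt c.2.1 (lt_of_le_of_lt (degree_smul_le _ _) hsd'))
        · simp [hs0]
      · exact V.sub_mem c.2.2 (V.smul_mem _ hs)
      · exact lt_of_le_of_lt (degree_add_le _ _)
            (max_lt (up _ v.1.2.1) (lt_of_le_of_lt (degree_smul_le _ _) hsd'))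
      · exact V.add_mem v.1.2.2 (V.smul_mem _ hs)
      · rintro ⟨c, hc⟩
        simp
      · rintro ⟨⟨c, hc⟩, a⟩
        have : c.coeff n = 0 := Polynomial.coeff_eq_zero_of_degree_lt hc.1
        simp [this, hs0]
    · rw [if_neg hS, add_zero, ← ih]
      refine Nat.card_congr (Equiv.subtypeEquivRight fun c => ?_)
      constructor
      · rintro ⟨h1, h2⟩
        refine ⟨key c h1 ?_, h2⟩
        by_contra h0
        refine hS ⟨c, h2, le_antisymm ?_ (le_degree_of_ne_zero h0)⟩
        rw [Polynomial.degree_le_iff_coeff_zero]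
        intro k hk
        rw [Polynomial.degree_lt_iff_coeff_zero] at h1
        exact h1 k (by exact_mod_cast hk)
      · rintro ⟨h1, h2⟩
        exact ⟨up c h1, h2⟩

/-- polynomials whose derivative is divisible by `Q`. -/
def derivDvd {F : Type*} [Field F] (Q : F[X]) : Submodule F F[X] where
  carrier := {c | Q ∣ derivative c}
  zero_mem' := by simp
  add_mem' := by
    intro a b ha hb
    simp only [Set.mem_setOf_eq, derivative_add] at *
    exact dvd_add ha hb
  smul_mem' := by
    intro a b hb
    simp only [Set.mem_setOf_eq, derivative_smul] at *
    exact hb.trans (by rw [smul_eq_C_mul]; exact dvd_mul_left _ _)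

lemma mem_derivDvd {F : Type*} [Field F] (Q c : F[X]) :
    c ∈ derivDvd Q ↔ Q ∣ derivative c := Iff.rfl

lemma degIn_add {F : Type*} [Field F] (p : ℕ) [CharP F p] (Q : F[X]) (d : ℕ)
    (h : DegIn (derivDvd Q) d) : DegIn (derivDvd Q) (d + p) := by
  obtain ⟨c, hc, hd⟩ := h
  refine ⟨c * X ^ p, ?_, ?_⟩
  · rw [mem_derivDvd] at *
    simp only [derivative_mul, derivative_X_pow, CharP.cast_eq_zero, map_zero, zero_mul,
      mul_zero, add_zero]
    exact hc.mul_right _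
  · rw [degree_mul, hd, degree_X_pow]; norm_cast

lemma degIn_small {F : Type*} [Field F] (p : ℕ) [CharP F p] (Q : F[X]) (d : ℕ)
    (hdQ : d ≤ Q.natDegree) (h : DegIn (derivDvd Q) d) : p ∣ d := by
  obtain ⟨c, hc, hd⟩ := h
  rw [mem_derivDvd] at hc
  have hc0 : c ≠ 0 := by rintro rfl; simp at hd
  rcases Nat.eq_zero_or_pos d with rfl | hpos
  · simp
  have hnd : c.natDegree = d := natDegree_eq_of_degree_eq_some hd
  have hz : derivative c = 0 := by
    by_contra hne
    have h1 := natDegree_le_of_dvd hc hne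
    have h2 := natDegree_derivative_lt (p := c) (by omega)
    omega
  have h3 : (derivative c).coeff (d - 1) = 0 := by rw [hz]; simp
  rw [coeff_derivative] at h3
  have h4 : c.coeff d ≠ 0 := Polynomial.coeff_ne_zero_of_eq_degree hd
  have h5 : d - 1 + 1 = d := by omega
  rw [h5] at h3
  have h6 : ((d - 1 : ℕ) : F) + 1 = (d : F) := by
    rw [← Nat.cast_add_one, h5]
  rw [h6] at h3
  exact (CharP.cast_eq_zero_iff F p d).1 ((mul_eq_zero.1 h3).resolve_left h4)

open Classical in
lemma count_top {F : Type*} [Field F] (n : ℕ) : Nat.count (DegIn (⊤ : Submodule F F[X])) n = n := by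
  rw [Nat.count_iff_forall]
  intro k _
  exact ⟨X ^ k, trivial, degree_X_pow k⟩

open Classical in
lemma count_large {F : Type*} [Field F] [Fintype F] (Q : F[X]) (hQ : Squarefree Q) (n : ℕ)
    (hn : 2 * Q.natDegree ≤ n) : Nat.count (DegIn (derivDvd Q)) n + Q.natDegree ≤ n := by
  have hQ0 : Q ≠ 0 := hQ.ne_zero
  have hsep : Q.Separable := PerfectField.separable_iff_squarefree.2 hQ
  have hcop : IsCoprime Q (derivative Q) := hsep
  have c1 := card_eq_pow_count (derivDvd Q) n
  have c2 := card_eq_pow_count (⊤ : Submodule F F[X]) n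
  have c3 := card_eq_pow_count (⊤ : Submodule F F[X]) Q.natDegree
  rw [count_top] at c2 c3
  have hfin : Finite {c : F[X] // c.degree < (n : WithBot ℕ) ∧ c ∈ (⊤ : Submodule F F[X])} := by
    apply Nat.finite_of_card_ne_zero
    rw [c2]; exact pow_ne_zero _ Fintype.card_ne_zero
  let f : {c : F[X] // c.degree < (n : WithBot ℕ) ∧ c ∈ derivDvd Q} ×
      {c : F[X] // c.degree < (Q.natDegree : WithBot ℕ) ∧ c ∈ (⊤ : Submodule F F[X])} →
      {c : F[X] // c.degree < (n : WithBot ℕ) ∧ c ∈ (⊤ : Submodule F F[X])} :=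
    fun v => ⟨v.1.1 + Q * v.2.1, by
      refine ⟨lt_of_le_of_lt (degree_add_le _ _) (max_lt v.1.2.1 ?_), trivial⟩
      by_cases h0 : v.2.1 = 0
      · rw [h0]; simpa using WithBot.bot_lt_coe n
      have h1 := v.2.2.1
      rw [degree_eq_natDegree h0] at h1
      rw [degree_mul, degree_eq_natDegree h0, degree_eq_natDegree hQ0]
      norm_cast at h1 ⊢
      omega⟩
  have hf : Function.Injective f := by
    rintro ⟨⟨v, hv⟩, ⟨a, ha⟩⟩ ⟨⟨w, hw⟩, ⟨b, hb⟩⟩ h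
    have h : v + Q * a = w + Q * b := congrArg Subtype.val h
    have h1 : w - v = Q * (a - b) := by linear_combination -h
    have h2 : Q * (a - b) ∈ derivDvd Q := h1 ▸ (derivDvd Q).sub_mem hw.2 hv.2
    rw [mem_derivDvd, derivative_mul] at h2
    have h3 : Q ∣ derivative Q * (a - b) := (dvd_add_left (dvd_mul_right _ _)).1 h2
    have h4 : Q ∣ a - b := hcop.dvd_of_dvd_mul_left h3
    have h5 : a - b = 0 := by
      apply eq_zero_of_dvd_of_degree_lt h4
      rw [degree_eq_natDegree hQ0]
      exact lt_of_le_of_lt (degree_sub_le _ _) (max_lt ha.1 hb.1)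
    have h6 : a = b := sub_eq_zero.1 h5
    subst h6
    have h7 : v = w := by linear_combination h
    subst h7
    rfl
  have hc := Nat.card_le_card_of_injective f hf
  rw [Nat.card_prod, c1, c2, c3, ← pow_add] at hc
  exact (Nat.pow_le_pow_iff_right Fintype.one_lt_card).1 hc

lemma count_dvd (p n : ℕ) : Nat.count (p ∣ ·) (n + 1) = n / p + 1 := by
  induction n with
  | zero => simp [Nat.count_succ]
  | succ n ih => rw [Nat.count_succ, ih, Nat.succ_div]; ring

lemma convex_aux (p : ℕ) (S : ℕ → Prop) [DecidablePred S] (hS : ∀ d, S d → S (d + p)) :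
    (∀ a k : ℕ, (Nat.count S (a + k * p) : ℤ) - Nat.count S a ≤
      k * ((Nat.count S (a + k * p + p) : ℤ) - Nat.count S (a + k * p))) ∧
    (∀ a k : ℕ, k * ((Nat.count S (a + p) : ℤ) - Nat.count S a) ≤
      (Nat.count S (a + k * p) : ℤ) - Nat.count S a) := by
  have hg : Monotone (fun a => (Nat.count S (a + p) : ℤ) - Nat.count S a) := by
    apply monotone_nat_of_le_succ
    intro a
    have e : a + 1 + p = a + p + 1 := by ring
    rw [e, Nat.count_succ, Nat.count_succ]
    by_cases h : S a
    · simp [h, hS a h]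
    · rw [if_neg h]; push_cast; split_ifs <;> simp
  constructor
  · intro a k
    induction k with
    | zero => simp
    | succ k ih =>
      have h1 := hg (show a + k * p ≤ a + (k+1) * p by nlinarith)
      have e : a + (k + 1) * p = a + k * p + p := by ring
      simp only [e] at h1 ⊢
      push_cast
      nlinarith
  · intro a k
    induction k with
    | zero => simp
    | succ k ih =>
      have h1 := hg (show a ≤ a + k * p by nlinarith)
      have e : a + (k + 1) * p = a + k * p + p := by ring
      simp only [e] at h1 ⊢
      push_cast
      nlinarith

open Classical in
lemma main_count (p : ℕ) (hp : 2 < p) (F : Type*) [Field F] [Fintype F] [CharP F p]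
    (Q : F[X]) (hQ : Squarefree Q) (r : ℕ) (h1 : Q.natDegree < r) (h2 : r < 2 * Q.natDegree) :
    (Nat.count (DegIn (derivDvd Q)) (r + 1) : ℝ) ≤
      (r : ℝ) / 2 + (1 / 2 - 1 / (p : ℝ)) * ((r : ℝ) - 2 * (Q.natDegree : ℝ)) + 2 * (p : ℝ) := by
  set S := DegIn (derivDvd Q) with hSdef
  have hS : ∀ d, S d → S (d + p) := degIn_add p Q
  set m := Q.natDegree with hm
  obtain ⟨cv1, cv2⟩ := convex_aux p S hS
  set k := (r - m) / p with hk
  set t := (r - m) % p with ht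
  have htp : t < p := Nat.mod_lt _ (by omega)
  have hr : r = m + t + k * p := by
    have := Nat.div_add_mod' (r - m) p
    rw [← hk, ← ht] at this
    omega
  -- the upper point
  obtain ⟨l, hl1, hl2⟩ : ∃ l : ℕ, 2 * m ≤ r + l * p ∧ r + l * p < 2 * m + p := by
    refine ⟨(2 * m - r + (p - 1)) / p, ?_, ?_⟩
    · have a1 := Nat.div_add_mod' (2 * m - r + (p - 1)) p
      have a2 := Nat.mod_lt (2 * m - r + (p - 1)) (show p > 0 by omega)
      omega
    · have a1 := Nat.div_mul_le_self (2 * m - r + (p - 1)) p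
      omega
  have hl0 : 0 < l := by
    rcases Nat.eq_zero_or_pos l with h | h
    · rw [h] at hl1; omega
    · exact h
  have B1 := count_large Q hQ (r + 1 + l * p) (by omega)
  have B0 : Nat.count S (m + 1 + t) ≤ m / p + p := by
    rw [Nat.count_add]
    have a1 : Nat.count S (m + 1) ≤ Nat.count (p ∣ ·) (m + 1) := by
      rw [Nat.count_eq_card_filter_range, Nat.count_eq_card_filter_range]
      apply Finset.card_le_card
      intro d hd
      rw [Finset.mem_filter, Finset.mem_range] at *
      exact ⟨hd.1, degIn_small p Q d (by omega) hd.2⟩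
    rw [count_dvd] at a1
    have a2 := Nat.count_le (p := fun k => S (m + 1 + k)) (n := t)
    omega
  have C1 := cv1 (m + 1 + t) k
  have C2 := cv2 (r + 1) l
  have e : m + 1 + t + k * p = r + 1 := by omega
  rw [e] at C1
  set D := Nat.count S (r + 1)
  set D0 := Nat.count S (m + 1 + t)
  set D1 := Nat.count S (r + 1 + l * p)
  set g : ℤ := (Nat.count S (r + 1 + p) : ℤ) - D
  have C3 : (l : ℤ) * (D - D0) ≤ k * (D1 - D) := by
    have x1 := mul_le_mul_of_nonneg_left C1 (Int.natCast_nonneg l)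
    have x2 := mul_le_mul_of_nonneg_left C2 (Int.natCast_nonneg k)
    linarith [mul_left_comm (l : ℤ) k g]
  have C3r : (l : ℝ) * (D - D0) ≤ k * (D1 - D) := by exact_mod_cast C3
  have hpR : (2 : ℝ) < p := by exact_mod_cast hp
  have B0r : (D0 : ℝ) ≤ m / p + p := by
    have : (D0 : ℝ) ≤ ((m / p : ℕ) : ℝ) + p := by exact_mod_cast B0
    have h := Nat.cast_div_le (α := ℝ) (m := m) (n := p)
    linarith
  have B1r : (D1 : ℝ) + m ≤ r + 1 + l * p := by exact_mod_cast B1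
  have hrR : (r : ℝ) = m + t + k * p := by exact_mod_cast hr
  have hl2R : (r : ℝ) + l * p ≤ 2 * m + p := by exact_mod_cast hl2.le
  have hlR : (0 : ℝ) < l := by exact_mod_cast hl0
  have hkR : (0 : ℝ) ≤ k := Nat.cast_nonneg k
  have htR : (0 : ℝ) ≤ t := Nat.cast_nonneg t
  set u : ℝ := 1 / p with hu
  have hup : u * p = 1 := by rw [hu]; field_simp
  have hu0 : 0 < u := by positivity
  have hu1 : u < 1 := by nlinarith
  have hmp : (m : ℝ) / p = m * u := by rw [hu]; ring
  rw [hmp] at B0r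
  set L : ℝ := (r : ℝ) / 2 + (1 / 2 - u) * ((r : ℝ) - 2 * (m : ℝ)) with hL
  -- lower endpoint
  have E0 : (D0 : ℝ) ≤ L - (k * p) * (1 - u) + 2 * p := by
    have : L - (k * p) * (1 - u) = m * u + t * (1 - u) := by
      rw [hL, hrR]; ring
    rw [this]
    nlinarith [mul_nonneg htR (sub_nonneg.2 hu1.le)]
  have E1 : (D1 : ℝ) ≤ L + (l * p) * (1 - u) + 2 * p := by
    have : L + (l * p) * (1 - u) = (r + l * p - m) - (r + l * p - 2 * m) * u := by
      rw [hL]; ring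
    rw [this]
    have : (r + l * p - 2 * m) * u ≤ p * u :=
      mul_le_mul_of_nonneg_right (by linarith) hu0.le
    nlinarith
  have F0 := mul_le_mul_of_nonneg_left E0 hlR.le
  have F1 := mul_le_mul_of_nonneg_left E1 hkR
  have G : ((l : ℝ) + k) * D ≤ (l + k) * (L + 2 * p) := by
    nlinarith
  exact le_of_mul_le_mul_left G (by linarith)

open Classical in
lemma card_eq_final {F : Type*} [Field F] [Fintype F] (Q : F[X]) (r : ℕ) :
    (Nat.card {c : F[X] // c.degree ≤ (r : WithBot ℕ) ∧ Q ∣ derivative c} : ℝ) =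
      (Fintype.card F : ℝ) ^ ((Nat.count (DegIn (derivDvd Q)) (r + 1) : ℕ) : ℝ) := by
  rw [Real.rpow_natCast, ← Nat.cast_pow, ← card_eq_pow_count]
  congr 1
  refine Nat.card_congr (Equiv.subtypeEquivRight fun c => ?_)
  rw [mem_derivDvd, Polynomial.degree_le_iff_coeff_zero, Polynomial.degree_lt_iff_coeff_zero]
  refine and_congr_left fun _ => forall_congr' fun k => ?_
  rw [Nat.cast_lt, Nat.succ_le_iff]

/-- Let `F_q` be a finite field of characteristic `p > 2` and `Q ∈ F_q[x]` squarefree. For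
every integer `r`, the number of `c ∈ F_q[x]` with `deg c ≤ r` and `Q ∣ c'` is at most
`q^{r/2 + (1/2 − 1/p)(r − 2 deg Q) + 2p}` when `deg Q < r < 2 deg Q`, and at most
`q^{r/2 + (r − 2 deg Q)/2 + 2p}` when `r ≥ 2 deg Q`. -/
theorem stmt_17 (p : ℕ) (hp : p.Prime) (hp2 : 2 < p)
    (Fq : Type*) [Field Fq] [Fintype Fq] [CharP Fq p]
    (Q : Polynomial Fq) (hQsf : Squarefree Q) (r : ℕ) :
    (Q.natDegree < r → r < 2 * Q.natDegree →
      (Nat.card {c : Polynomial Fq //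
          c.degree ≤ (r : WithBot ℕ) ∧ Q ∣ Polynomial.derivative c} : ℝ) ≤
        (Fintype.card Fq : ℝ) ^
          ((r : ℝ) / 2 + (1 / 2 - 1 / (p : ℝ)) * ((r : ℝ) - 2 * (Q.natDegree : ℝ)) +
            2 * (p : ℝ))) ∧
    (2 * Q.natDegree ≤ r →
      (Nat.card {c : Polynomial Fq //
          c.degree ≤ (r : WithBot ℕ) ∧ Q ∣ Polynomial.derivative c} : ℝ) ≤
        (Fintype.card Fq : ℝ) ^
          ((r : ℝ) / 2 + ((r : ℝ) - 2 * (Q.natDegree : ℝ)) / 2 + 2 * (p : ℝ))) := by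
  classical
  have hq : (1 : ℝ) ≤ (Fintype.card Fq : ℝ) := by
    exact_mod_cast Fintype.card_pos (α := Fq)
  constructor
  · intro h1 h2
    rw [card_eq_final]
    exact Real.rpow_le_rpow_of_exponent_le hq (main_count p hp2 Fq Q hQsf r h1 h2)
  · intro h
    rw [card_eq_final]
    refine Real.rpow_le_rpow_of_exponent_le hq ?_
    have h1 := count_large Q hQsf (r + 1) (by omega)
    have h2 : (Nat.count (DegIn (derivDvd Q)) (r + 1) : ℝ) + Q.natDegree ≤ r + 1 := by
      exact_mod_cast h1
    have h3 : (2 : ℝ) < p := by exact_mod_cast hp2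
    linarith
end
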